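/- arXiv:1908.03546 — 11 statements merged into one kernel-verified Lean document; each statement's English description precedes it below -/
import Mathlib

section
/- Let (T, F) be a pretorsion theory in a category C, with Z := T ∩ F, and let X be any object of C. Then: (a) if every morphism from X to an object of F is Z-trivial, then X belongs to T; (b) if every morphism from an object of T to X is Z-trivial, then X belongs to F. -/
open CategoryTheory Limits

universe w v u

variable {𝒞 : Type u} [Category.{v} 𝒞]

/-- A morphism is `Z`-trivial if it factors through an object of `Z`. -/
def ZTrivial (Z : Set 𝒞) {A B : 𝒞} (f : A ⟶ B) : Prop :=
  ∃ (M : 𝒞) (g : A ⟶ M) (h : M ⟶ B), M ∈ Z ∧ g ≫ h = f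

/-- `ε : X ⟶ A` is a `Z`-prekernel of `f : A ⟶ A'`. -/
def IsZPrekernel (Z : Set 𝒞) {X A A' : 𝒞} (ε : X ⟶ A) (f : A ⟶ A') : Prop :=
  ZTrivial Z (ε ≫ f) ∧
    ∀ ⦃Y : 𝒞⦄ (l : Y ⟶ A), ZTrivial Z (l ≫ f) → ∃! l' : Y ⟶ X, l' ≫ ε = l

/-- `η : A' ⟶ X` is a `Z`-precokernel of `f : A ⟶ A'`. -/
def IsZPrecokernel (Z : Set 𝒞) {A A' X : 𝒞} (η : A' ⟶ X) (f : A ⟶ A') : Prop :=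
  ZTrivial Z (f ≫ η) ∧
    ∀ ⦃Y : 𝒞⦄ (m : A' ⟶ Y), ZTrivial Z (f ≫ m) → ∃! m' : X ⟶ Y, η ≫ m' = m

/-- `A ⟶ B ⟶ C` is a short `Z`-preexact sequence. -/
def ShortZPreexact (Z : Set 𝒞) {A B C : 𝒞} (f : A ⟶ B) (g : B ⟶ C) : Prop :=
  IsZPrekernel Z f g ∧ IsZPrecokernel Z g f

/-- A pretorsion theory `(T, F)` in a category `𝒞`, where `T` and `F` are replete
full subcategories (given as classes of objects), `Z := T ∩ F`. -/
structure IsPretorsionTheory (T F : Set 𝒞) : Prop where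
  repleteT : ∀ ⦃X Y : 𝒞⦄, (X ≅ Y) → X ∈ T → Y ∈ T
  repleteF : ∀ ⦃X Y : 𝒞⦄, (X ≅ Y) → X ∈ F → Y ∈ F
  trivial_hom : ∀ ⦃X Y : 𝒞⦄, X ∈ T → Y ∈ F → ∀ f : X ⟶ Y, ZTrivial (T ∩ F) f
  exists_seq : ∀ B : 𝒞, ∃ (A C : 𝒞) (f : A ⟶ B) (g : B ⟶ C),
    A ∈ T ∧ C ∈ F ∧ ShortZPreexact (T ∩ F) f g

/-- An extremal epimorphism: whenever it factors through a monomorphism,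
that monomorphism is an isomorphism. -/
def IsExtremalEpi {X Y : 𝒞} (f : X ⟶ Y) : Prop :=
  ∀ ⦃I : 𝒞⦄ (u : X ⟶ I) (m : I ⟶ Y), Mono m → u ≫ m = f → IsIso m

/-- (a) If every morphism from `X` to an object of `F` is `Z`-trivial then `X ∈ T`;
(b) if every morphism from an object of `T` to `X` is `Z`-trivial then `X ∈ F`. -/
theorem stmt4 {T F : Set 𝒞} (h : IsPretorsionTheory T F) (X : 𝒞) :
    ((∀ ⦃G : 𝒞⦄, G ∈ F → ∀ u : X ⟶ G, ZTrivial (T ∩ F) u) → X ∈ T) ∧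
    ((∀ ⦃S : 𝒞⦄, S ∈ T → ∀ u : S ⟶ X, ZTrivial (T ∩ F) u) → X ∈ F) := by
  obtain ⟨A, C, f, g, hA, hC, hk, hc⟩ := h.exists_seq X
  constructor
  · intro H
    obtain ⟨s, hs, -⟩ := hk.2 (𝟙 X) (by simpa using H hC g)
    have hfs : f ≫ s = 𝟙 A :=
      (hk.2 f hk.1).unique (by simp [hs]) (by simp)
    exact h.repleteT ⟨f, s, hfs, hs⟩ hA
  · intro H
    obtain ⟨s, hs, -⟩ := hc.2 (𝟙 X) (by simpa using H hA f)
    have hsg : s ≫ g = 𝟙 C :=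
      (hc.2 g hc.1).unique (by rw [← Category.assoc, hs, Category.id_comp]) (by simp)
    exact h.repleteF ⟨s, g, hsg, hs⟩ hC
end

section
/- Let (T, F) be a pretorsion theory in a category C, with Z := T ∩ F. Then the three classes T, F and Z are all closed under retracts: if X is an object of C and there exist morphisms f : X → S and g : S → X with g ∘ f = 1_X, where S belongs to T (respectively F, respectively Z), then X belongs to T (respectively F, respectively Z). -/
open CategoryTheory Limits

universe w v u

variable {𝒞 : Type u} [Category.{v} 𝒞]

/-- The classes `T`, `F` and `Z = T ∩ F` of a pretorsion theory are closed under
retracts. -/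
theorem stmt5 {T F : Set 𝒞} (h : IsPretorsionTheory T F) {X S : 𝒞}
    (f : X ⟶ S) (g : S ⟶ X) (hfg : f ≫ g = 𝟙 X) :
    (S ∈ T → X ∈ T) ∧ (S ∈ F → X ∈ F) ∧ (S ∈ T ∩ F → X ∈ T ∩ F) := by
  have hT : S ∈ T → X ∈ T := by
    intro hS
    obtain ⟨A, C, a, b, hA, hC, ⟨hab, hk⟩, -⟩ := h.exists_seq X
    obtain ⟨s, hs, -⟩ := hk g (h.trivial_hom hS hC _)
    have h1 : (f ≫ s) ≫ a = 𝟙 X := by rw [Category.assoc, hs, hfg]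
    have h2 : a ≫ f ≫ s = 𝟙 A :=
      (hk a hab).unique (by rw [Category.assoc, h1, Category.comp_id]) (Category.id_comp a)
    exact h.repleteT ⟨a, f ≫ s, h2, h1⟩ hA
  have hF : S ∈ F → X ∈ F := by
    intro hS
    obtain ⟨A, C, a, b, hA, hC, -, ⟨hab, hk⟩⟩ := h.exists_seq X
    obtain ⟨t, ht, -⟩ := hk f (h.trivial_hom hA hS _)
    have h1 : b ≫ t ≫ g = 𝟙 X := by rw [← Category.assoc, ht, hfg]
    have h2 : (t ≫ g) ≫ b = 𝟙 C :=
      (hk b hab).unique (by rw [← Category.assoc, h1, Category.id_comp]) (Category.comp_id b)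
    exact h.repleteF ⟨t ≫ g, b, h2, h1⟩ hC
  exact ⟨hT, hF, fun hS => ⟨hT hS.1, hF hS.2⟩⟩
end

section
/- Let (T, F) be a pretorsion theory in a category C, with Z := T ∩ F. If T →ε A →η F and T' →ε' A →η' F' are short Z-preexact sequences with T, T' in T and F, F' in F, then there exists a unique isomorphism α : T → T' with ε = ε' ∘ α, and a unique isomorphism σ : F → F' with σ ∘ η = η'. -/
open CategoryTheory Limits

universe w v u

variable {𝒞 : Type u} [Category.{v} 𝒞]

/-- Uniqueness (up to unique isomorphisms) of the short `Z`-preexact sequence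
associated with an object. -/
theorem stmt6 {T F : Set 𝒞} (h : IsPretorsionTheory T F)
    {T₁ T₂ F₁ F₂ A : 𝒞} (ε : T₁ ⟶ A) (η : A ⟶ F₁) (ε' : T₂ ⟶ A) (η' : A ⟶ F₂)
    (h₁ : ShortZPreexact (T ∩ F) ε η) (h₂ : ShortZPreexact (T ∩ F) ε' η')
    (hT₁ : T₁ ∈ T) (hT₂ : T₂ ∈ T) (hF₁ : F₁ ∈ F) (hF₂ : F₂ ∈ F) :
    (∃! α : T₁ ≅ T₂, α.hom ≫ ε' = ε) ∧ (∃! σ : F₁ ≅ F₂, η ≫ σ.hom = η') := by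
  constructor
  · obtain ⟨a, ha, -⟩ := h₂.1.2 ε (h.trivial_hom hT₁ hF₂ _)
    obtain ⟨b, hb, -⟩ := h₁.1.2 ε' (h.trivial_hom hT₂ hF₁ _)
    refine ⟨⟨a, b, ?_, ?_⟩, ha, ?_⟩
    · exact (h₁.1.2 ε h₁.1.1).unique (by rw [Category.assoc, hb, ha]) (Category.id_comp _)
    · exact (h₂.1.2 ε' h₂.1.1).unique (by rw [Category.assoc, ha, hb]) (Category.id_comp _)
    · intro β hβ
      ext
      exact (h₂.1.2 ε (h.trivial_hom hT₁ hF₂ _)).unique hβ ha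
  · obtain ⟨a, ha, -⟩ := h₁.2.2 η' (h.trivial_hom hT₁ hF₂ _)
    obtain ⟨b, hb, -⟩ := h₂.2.2 η (h.trivial_hom hT₂ hF₁ _)
    refine ⟨⟨a, b, ?_, ?_⟩, ha, ?_⟩
    · exact (h₁.2.2 η h₁.2.1).unique (by rw [← Category.assoc, ha, hb]) (Category.comp_id _)
    · exact (h₂.2.2 η' h₂.2.1).unique (by rw [← Category.assoc, hb, ha]) (Category.comp_id _)
    · intro β hβ
      ext
      exact (h₁.2.2 η' (h.trivial_hom hT₁ hF₂ _)).unique hβ ha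
end

section
/- Let (T, F) be a pretorsion theory in a category C, with Z := T ∩ F. Let B be an object of T and let A →e B →p F' be a short Z-preexact sequence with A in T and F' in F. Then e is an isomorphism and F' belongs to Z. -/
open CategoryTheory Limits

universe w v u

variable {𝒞 : Type u} [Category.{v} 𝒞]

theorem isIso_of_prekernel_trivial {Z : Set 𝒞} {X A A' : 𝒞} (e : X ⟶ A) (f : A ⟶ A')
    (hk : IsZPrekernel Z e f) (hf : ZTrivial Z f) : IsIso e := by
  obtain ⟨s, hs, -⟩ := hk.2 (𝟙 A) (by simpa using hf)
  refine ⟨s, ?_, hs⟩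
  exact (hk.2 e hk.1).unique (by simp only [Category.assoc, hs, Category.comp_id]) (by simp)

/-- If `B ∈ T` and `A ⟶ B ⟶ F'` is a short `Z`-preexact sequence with `A ∈ T`,
`F' ∈ F`, then `e` is an isomorphism and `F' ∈ Z = T ∩ F`. -/
theorem stmt10 {T F : Set 𝒞} (h : IsPretorsionTheory T F) {A B F' : 𝒞}
    (hB : B ∈ T) (e : A ⟶ B) (p : B ⟶ F') (hseq : ShortZPreexact (T ∩ F) e p)
    (hA : A ∈ T) (hF' : F' ∈ F) :
    IsIso e ∧ F' ∈ T ∩ F := by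
  have hp := h.trivial_hom hB hF' p
  refine ⟨isIso_of_prekernel_trivial e p hseq.1 hp, ?_, hF'⟩
  obtain ⟨M, g, k, hM, hgk⟩ := hp
  obtain ⟨g', hg', -⟩ := hseq.2.2 g ⟨M, e ≫ g, 𝟙 M, hM, by simp⟩
  have hr : g' ≫ k = 𝟙 F' :=
    (hseq.2.2 p hseq.2.1).unique (by rw [← Category.assoc, hg', hgk]) (by simp)
  obtain ⟨X, Y, f, q, hX, hY, hfq⟩ := h.exists_seq F'
  have hq : ZTrivial (T ∩ F) q := by
    refine ⟨M, g', k ≫ q, hM, ?_⟩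
    rw [← Category.assoc, hr, Category.id_comp]
  have := isIso_of_prekernel_trivial f q hfq.1 hq
  exact h.repleteT (asIso f) hX
end

section
/- Let (T, F) be a pretorsion theory in a category C, with Z := T ∩ F. Let A be an object of C, let T₁ → A → F₁ be a short Z-preexact sequence with T₁ in T and F₁ in F, and let T₂ → F₁ → F₂ be a short Z-preexact sequence with T₂ in T and F₂ in F. Then A belongs to Z if and only if A is isomorphic to T₂. -/
open CategoryTheory Limits

universe w v u

variable {𝒞 : Type u} [Category.{v} 𝒞]

/-- `Z` consists exactly of the objects `A` isomorphic to `t(f(A))`. -/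
theorem stmt12 {T F : Set 𝒞} (h : IsPretorsionTheory T F)
    {A T₁ F₁ T₂ F₂ : 𝒞} (f₁ : T₁ ⟶ A) (g₁ : A ⟶ F₁) (f₂ : T₂ ⟶ F₁) (g₂ : F₁ ⟶ F₂)
    (h₁ : ShortZPreexact (T ∩ F) f₁ g₁) (h₂ : ShortZPreexact (T ∩ F) f₂ g₂)
    (hT₁ : T₁ ∈ T) (hF₁ : F₁ ∈ F) (hT₂ : T₂ ∈ T) (hF₂ : F₂ ∈ F) :
    A ∈ T ∩ F ↔ Nonempty (A ≅ T₂) := by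
  obtain ⟨⟨hk₁, uk₁⟩, hc₁, uc₁⟩ := h₁
  obtain ⟨⟨hk₂, uk₂⟩, hc₂, uc₂⟩ := h₂
  -- a split epi `f₂` is an isomorphism
  have key : ∀ s : F₁ ⟶ T₂, s ≫ f₂ = 𝟙 F₁ → Nonempty (F₁ ≅ T₂) := fun s hs =>
    ⟨⟨s, f₂, hs, (uk₂ f₂ hk₂).unique (by simp [hs]) (by simp)⟩⟩
  have lift₂ : ∀ {X : 𝒞}, X ∈ T → ∀ k : X ⟶ F₁, ∃ l : X ⟶ T₂, l ≫ f₂ = k := fun hX k =>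
    (uk₂ k (h.trivial_hom hX hF₂ _)).exists
  constructor
  · rintro ⟨hAT, hAF⟩
    obtain ⟨r, hr⟩ := (uc₁ (𝟙 A) (h.trivial_hom hT₁ hAF _)).exists
    have hr' : r ≫ g₁ = 𝟙 F₁ :=
      (uc₁ g₁ hc₁).unique (by rw [← Category.assoc, hr, Category.id_comp]) (by simp)
    have i : A ≅ F₁ := ⟨g₁, r, hr, hr'⟩
    obtain ⟨s, hs⟩ := lift₂ (h.repleteT i hAT) (𝟙 F₁)
    obtain ⟨j⟩ := key s hs
    exact ⟨i ≪≫ j⟩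
  · rintro ⟨i⟩
    have hAT : A ∈ T := h.repleteT i.symm hT₂
    obtain ⟨M, a, m, hM, ham⟩ := h.trivial_hom hAT hF₁ g₁
    obtain ⟨s, hs⟩ := (uc₁ a (h.trivial_hom hT₁ hM.2 _)).exists
    have hsm : s ≫ m = 𝟙 F₁ :=
      (uc₁ g₁ hc₁).unique (by rw [← Category.assoc, hs, ham]) (by simp)
    obtain ⟨k, hk⟩ := lift₂ hM.1 m
    obtain ⟨j⟩ := key (s ≫ k) (by rw [Category.assoc, hk, hsm])
    exact ⟨hAT, h.repleteF (j ≪≫ i.symm) hF₁⟩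
end

section
/- Let (T, F) be a pretorsion theory in a category C, with Z := T ∩ F. Then the three subcategories T, F and Z are closed under Z-extensions: if S₁ → X → S₂ is a short Z-preexact sequence with S₁ and S₂ both in T (respectively both in F, respectively both in Z), then X belongs to T (respectively F, respectively Z). -/
open CategoryTheory Limits

universe w v u

variable {𝒞 : Type u} [Category.{v} 𝒞]

/-- The subcategories `T`, `F` and `Z = T ∩ F` of a pretorsion theory are closed
under `Z`-extensions. -/
theorem stmt13 {T F : Set 𝒞} (h : IsPretorsionTheory T F)
    {S₁ X S₂ : 𝒞} (f : S₁ ⟶ X) (g : X ⟶ S₂) (hseq : ShortZPreexact (T ∩ F) f g) :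
    (S₁ ∈ T → S₂ ∈ T → X ∈ T) ∧
    (S₁ ∈ F → S₂ ∈ F → X ∈ F) ∧
    (S₁ ∈ T ∩ F → S₂ ∈ T ∩ F → X ∈ T ∩ F) := by
  have key_T : S₁ ∈ T → S₂ ∈ T → X ∈ T := by
    intro h1 h2
    obtain ⟨A, C, a, b, hA, hC, ⟨hab, hker⟩, -⟩ := h.exists_seq X
    obtain ⟨m, hm, -⟩ := hseq.2.2 b (h.trivial_hom h1 hC (f ≫ b))
    obtain ⟨M, p, q, hM, hpq⟩ := h.trivial_hom h2 hC m
    obtain ⟨l, hl, -⟩ := hker (𝟙 X) ⟨M, g ≫ p, q, hM, by simp [hpq, hm]⟩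
    have hl' : a ≫ l = 𝟙 A := (hker a hab).unique (by simp [hl]) (by simp)
    exact h.repleteT ⟨a, l, hl', hl⟩ hA
  have key_F : S₁ ∈ F → S₂ ∈ F → X ∈ F := by
    intro h1 h2
    obtain ⟨A, C, a, b, hA, hC, -, ⟨hab, hcok⟩⟩ := h.exists_seq X
    obtain ⟨m, hm, -⟩ := hseq.1.2 a (h.trivial_hom hA h2 (a ≫ g))
    obtain ⟨M, p, q, hM, hpq⟩ := h.trivial_hom hA h1 m
    obtain ⟨l, hl, -⟩ := hcok (𝟙 X) ⟨M, p, q ≫ f, hM, by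
      rw [← Category.assoc, hpq, hm, Category.comp_id]⟩
    have hl' : l ≫ b = 𝟙 C :=
      (hcok b hab).unique (by rw [← Category.assoc, hl, Category.id_comp]) (by simp)
    exact h.repleteF ⟨l, b, hl', hl⟩ hC
  exact ⟨key_T, key_F, fun h1 h2 => ⟨key_T h1.1 h2.1, key_F h1.2 h2.2⟩⟩
end

section
/- Let (T, F) be a pretorsion theory in a category C, with Z := T ∩ F, and let J be an index type. (a) Assume that every J-indexed family of objects of Z has a coproduct in C which again belongs to Z. If {X_j}_{j∈J} is a family of objects of T having a coproduct X in C, then X belongs to T. (b) Assume that every J-indexed family of objects of Z has a product in C which again belongs to Z. If {Y_j}_{j∈J} is a family of objects of F having a product Y in C, then Y belongs to F. -/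
open CategoryTheory Limits

universe w v u

variable {𝒞 : Type u} [Category.{v} 𝒞]

/-- (a) If `Z` is closed under `J`-indexed coproducts, then `T` is closed under
`J`-indexed coproducts; (b) if `Z` is closed under `J`-indexed products, then `F`
is closed under `J`-indexed products. -/
theorem stmt14 {T F : Set 𝒞} (h : IsPretorsionTheory T F) (J : Type w) :
    ((∀ Zf : J → 𝒞, (∀ j, Zf j ∈ T ∩ F) →
        ∃ c : Cofan Zf, Nonempty (IsColimit c) ∧ c.pt ∈ T ∩ F) →
      ∀ (Xf : J → 𝒞), (∀ j, Xf j ∈ T) →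
        ∀ c : Cofan Xf, IsColimit c → c.pt ∈ T) ∧
    ((∀ Zf : J → 𝒞, (∀ j, Zf j ∈ T ∩ F) →
        ∃ c : Fan Zf, Nonempty (IsLimit c) ∧ c.pt ∈ T ∩ F) →
      ∀ (Yf : J → 𝒞), (∀ j, Yf j ∈ F) →
        ∀ c : Fan Yf, IsLimit c → c.pt ∈ F) := by
  refine ⟨?_, ?_⟩
  · intro hZ Xf hX c hc
    obtain ⟨A, C, f, g, hA, hC, ⟨⟨M, p, q, hM, hpq⟩, huniv⟩, -⟩ := h.exists_seq c.pt
    choose Zf a b hZf hab using fun j => h.trivial_hom (hX j) hC (c.inj j ≫ g)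
    obtain ⟨d, ⟨hd⟩, hdZ⟩ := hZ Zf hZf
    have htriv : ZTrivial (T ∩ F) (𝟙 c.pt ≫ g) := by
      refine ⟨d.pt, Cofan.IsColimit.desc hc (fun j => a j ≫ d.inj j),
        Cofan.IsColimit.desc hd b, hdZ, ?_⟩
      refine Cofan.IsColimit.hom_ext hc _ _ (fun j => ?_)
      rw [← Category.assoc, Cofan.IsColimit.fac, Category.assoc, Cofan.IsColimit.fac, hab,
        Category.id_comp]
    obtain ⟨s, hs, -⟩ := huniv _ htriv
    have hs' : s ≫ f = 𝟙 c.pt := hs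
    have hfs : f ≫ s = 𝟙 A := by
      refine (huniv f ⟨M, p, q, hM, hpq⟩).unique ?_ (Category.id_comp f)
      rw [Category.assoc, hs', Category.comp_id]
    exact h.repleteT ⟨f, s, hfs, hs'⟩ hA
  · intro hZ Yf hY c hc
    obtain ⟨A, C, f, g, hA, hC, -, ⟨⟨M, p, q, hM, hpq⟩, huniv⟩⟩ := h.exists_seq c.pt
    choose Zf a b hZf hab using fun j => h.trivial_hom hA (hY j) (f ≫ c.proj j)
    obtain ⟨d, ⟨hd⟩, hdZ⟩ := hZ Zf hZf
    have htriv : ZTrivial (T ∩ F) (f ≫ 𝟙 c.pt) := by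
      refine ⟨d.pt, Fan.IsLimit.lift hd a,
        Fan.IsLimit.lift hc (fun j => d.proj j ≫ b j), hdZ, ?_⟩
      refine Fan.IsLimit.hom_ext hc _ _ (fun j => ?_)
      rw [Category.assoc, Fan.IsLimit.fac, ← Category.assoc, Fan.IsLimit.fac, hab,
        Category.comp_id]
    obtain ⟨s, hs, -⟩ := huniv _ htriv
    have hs' : g ≫ s = 𝟙 c.pt := hs
    have hsg : s ≫ g = 𝟙 C := by
      refine (huniv g ⟨M, p, q, hM, hpq⟩).unique ?_ (Category.comp_id g)
      rw [← Category.assoc, hs', Category.id_comp]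
    exact h.repleteF ⟨s, g, hsg, hs'⟩ hC
end

section
/- Let C be a category and Z a non-empty class of objects of C. If p : B → C is a Z-precokernel of some morphism q : X → B, and e : A → B is a Z-prekernel of p, then p is also a Z-precokernel of e; consequently A →e B →p C is a short Z-preexact sequence in C. -/
open CategoryTheory Limits

universe w v u

variable {𝒞 : Type u} [Category.{v} 𝒞]

/-- If `p` is a `Z`-precokernel of some morphism `q` and `e` is a `Z`-prekernel of
`p`, then `p` is also a `Z`-precokernel of `e`; hence `e, p` is a short
`Z`-preexact sequence. -/
theorem stmt15 (Z : Set 𝒞) (hZ : Z.Nonempty) {X A B C : 𝒞}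
    (q : X ⟶ B) (p : B ⟶ C) (hp : IsZPrecokernel Z p q)
    (e : A ⟶ B) (he : IsZPrekernel Z e p) :
    IsZPrecokernel Z p e ∧ ShortZPreexact Z e p := by
  have key : IsZPrecokernel Z p e := by
    refine ⟨he.1, fun Y m hm => hp.2 m ?_⟩
    obtain ⟨l, hl, -⟩ := he.2 q hp.1
    obtain ⟨M, g, h, hM, hgh⟩ := hm
    exact ⟨M, l ≫ g, h, hM, by rw [Category.assoc, hgh, ← Category.assoc, hl]⟩
  exact ⟨key, he, key⟩
end

section
/- Let C be a category and let Z be a non-empty class of objects of C each of which is projective (with respect to epimorphisms). If f : A → B is any morphism in C and p : B → C is a Z-precokernel of f, then p is a regular epimorphism (it is the coequalizer of some pair of parallel morphisms). -/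
open CategoryTheory Limits

universe w v u

variable {𝒞 : Type u} [Category.{v} 𝒞]

/-- If every object of `Z` is projective, then any `Z`-precokernel is a regular
epimorphism. -/
theorem stmt17 (Z : Set 𝒞) (hZ : Z.Nonempty) (hproj : ∀ P ∈ Z, Projective P)
    {A B C : 𝒞} (f : A ⟶ B) (p : B ⟶ C) (hp : IsZPrecokernel Z p f) :
    Nonempty (RegularEpi p) := by
  obtain ⟨⟨M, g, h, hM, hgh⟩, huniv⟩ := hp
  have hepi : Epi p := ⟨fun {Y} a b hab => by
    obtain ⟨c, -, hc⟩ := huniv (p ≫ a) ⟨M, g, h ≫ a, hM, by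
      rw [← Category.assoc, hgh, Category.assoc]⟩
    exact (hc a rfl).trans (hc b hab.symm).symm⟩
  haveI := hproj M hM
  have hk : Projective.factorThru h p ≫ p = h := Projective.factorThru_comp h p
  have key : ∀ {Y : 𝒞} (m : B ⟶ Y), f ≫ m = (g ≫ Projective.factorThru h p) ≫ m →
      ∃ m' : C ⟶ Y, p ≫ m' = m := fun m hm =>
    (huniv m ⟨M, g, Projective.factorThru h p ≫ m, hM, by
      rw [hm, Category.assoc]⟩).exists
  have w : f ≫ p = (g ≫ Projective.factorThru h p) ≫ p := by
    rw [Category.assoc, hk, hgh]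
  exact ⟨{
    W := A
    left := f
    right := g ≫ Projective.factorThru h p
    w := w
    isColimit := Cofork.IsColimit.mk _
      (fun s => (key s.π s.condition).choose)
      (fun s => (key s.π s.condition).choose_spec)
      (fun s m hm => by
        rw [← cancel_epi p]
        exact hm.trans (key s.π s.condition).choose_spec.symm) }⟩
end

section
/- Let (T, F) be a pretorsion theory in a category C and suppose every object of Z := T ∩ F is projective (with respect to epimorphisms). Then: (a) T is closed under extremal quotients, i.e., if g : S → C is an extremal epimorphism with S in T, then C belongs to T; (b) F is closed under subobjects, i.e., if n : N → G is a monomorphism with G in F, then N belongs to F. -/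
open CategoryTheory Limits

universe w v u

variable {𝒞 : Type u} [Category.{v} 𝒞]

/-- If the trivial objects of a pretorsion theory are projective, then `T` is
closed under extremal quotients and `F` is closed under subobjects. -/
theorem stmt18 {T F : Set 𝒞} (h : IsPretorsionTheory T F)
    (hproj : ∀ P ∈ T ∩ F, Projective P) :
    (∀ ⦃S C : 𝒞⦄ (g : S ⟶ C), IsExtremalEpi g → S ∈ T → C ∈ T) ∧
    (∀ ⦃N G : 𝒞⦄ (n : N ⟶ G), Mono n → G ∈ F → N ∈ F) := by
  refine ⟨?_, ?_⟩
  · intro S C g hg hS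
    obtain ⟨A, D, f, q, hA, hD, hk, -⟩ := h.exists_seq C
    have hf : Mono f := by
      refine ⟨fun {W} a b hab => ?_⟩
      obtain ⟨M, x, y, hM, hxy⟩ := hk.1
      exact (hk.2 (b ≫ f) ⟨M, b ≫ x, y, hM, by simp [hxy]⟩).unique hab rfl
    obtain ⟨u, hu, -⟩ := hk.2 g (h.trivial_hom hS hD _)
    have := hg u f hf hu
    exact h.repleteT (asIso f) hA
  · intro N G n hn hG
    obtain ⟨A, D, f, q, hA, hD, -, hc⟩ := h.exists_seq N
    obtain ⟨M, x, y, hM, hxy⟩ := hc.1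
    have hq : Epi q := by
      refine ⟨fun {W} a b hab => ?_⟩
      refine (hc.2 (q ≫ b) ⟨M, x, y ≫ b, hM, ?_⟩).unique hab rfl
      rw [← Category.assoc, hxy, Category.assoc]
    obtain ⟨n', hn', -⟩ := hc.2 n (h.trivial_hom hA hG _)
    have hqm : Mono q := by
      have : Mono (q ≫ n') := by rw [hn']; exact hn
      exact mono_of_mono q n'
    have := hproj M hM
    have hf : x ≫ Projective.factorThru y q = f := by
      rw [← cancel_mono q, Category.assoc, Projective.factorThru_comp, hxy]
    obtain ⟨r, hr, -⟩ := hc.2 (𝟙 N) ⟨M, x, _, hM, by rw [hf, Category.comp_id]⟩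
    have hr2 : r ≫ q = 𝟙 D := by
      rw [← cancel_epi q, ← Category.assoc, hr, Category.id_comp, Category.comp_id]
    exact h.repleteF ⟨r, q, hr2, hr⟩ hD
end

section
/- Let C be a category in which every morphism f has a factorization f = m ∘ p with p an extremal epimorphism and m a monomorphism. Let T and F be full replete subcategories of C such that every object of Z := T ∩ F is projective (with respect to epimorphisms), and assume that for every object X of C there exists a short Z-preexact sequence S → X → G with S in T and G in F. Then the following are equivalent: (a) (T, F) is a pretorsion theory in C; (b) T is closed under extremal quotients (if g : S → C is an extremal epimorphism with S in T, then C is in T) and F is closed under subobjects (if n : N → G is a monomorphism with G in F, then N is in F). -/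
open CategoryTheory Limits

universe w v u

variable {𝒞 : Type u} [Category.{v} 𝒞]

/-- In a category with (extremal epi, mono)-factorizations, if the objects of
`Z = T ∩ F` are projective and every object admits a short `Z`-preexact sequence
`T → X → F`, then `(T, F)` is a pretorsion theory iff `T` is closed under
extremal quotients and `F` is closed under subobjects. -/
theorem stmt19 {T F : Set 𝒞}
    (hfact : ∀ ⦃X Y : 𝒞⦄ (f : X ⟶ Y), ∃ (I : 𝒞) (p : X ⟶ I) (m : I ⟶ Y),
      IsExtremalEpi p ∧ Mono m ∧ p ≫ m = f)
    (hTrep : ∀ ⦃X Y : 𝒞⦄, (X ≅ Y) → X ∈ T → Y ∈ T)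
    (hFrep : ∀ ⦃X Y : 𝒞⦄, (X ≅ Y) → X ∈ F → Y ∈ F)
    (hproj : ∀ P ∈ T ∩ F, Projective P)
    (hseq : ∀ X : 𝒞, ∃ (S G : 𝒞) (f : S ⟶ X) (g : X ⟶ G),
      S ∈ T ∧ G ∈ F ∧ ShortZPreexact (T ∩ F) f g) :
    IsPretorsionTheory T F ↔
      ((∀ ⦃S C : 𝒞⦄ (g : S ⟶ C), IsExtremalEpi g → S ∈ T → C ∈ T) ∧
       (∀ ⦃N G : 𝒞⦄ (n : N ⟶ G), Mono n → G ∈ F → N ∈ F)) := by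
  constructor
  · intro h
    refine ⟨?_, ?_⟩
    · intro S C g hg hS
      obtain ⟨A, G, f, e, hA, hG, hk, hc⟩ := hseq C
      have hmono : Mono f := by
        refine ⟨fun {W} a b hab => ?_⟩
        obtain ⟨M, x, y, hM, hxy⟩ := hk.1
        have ht : ZTrivial (T ∩ F) ((a ≫ f) ≫ e) :=
          ⟨M, a ≫ x, y, hM, by rw [Category.assoc, hxy, Category.assoc]⟩
        exact (hk.2 (a ≫ f) ht).unique rfl hab.symm
      obtain ⟨l, hl, -⟩ := hk.2 g (h.trivial_hom hS hG _)
      have := hg l f hmono hl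
      exact hTrep (asIso f) hA
    · intro N G n hn hG
      obtain ⟨A, H, f, e, hA, hH, hk, hc⟩ := hseq N
      obtain ⟨M, x, y, hM, hxy⟩ := hc.1
      have hepi : Epi e := by
        refine ⟨fun {W} a b hab => ?_⟩
        have ht : ZTrivial (T ∩ F) (f ≫ (e ≫ a)) :=
          ⟨M, x, y ≫ a, hM, by rw [← Category.assoc, hxy, Category.assoc]⟩
        exact (hc.2 (e ≫ a) ht).unique rfl hab.symm
      obtain ⟨n', hn', -⟩ := hc.2 n (h.trivial_hom hA hG _)
      have hmono : Mono e := by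
        have : Mono (e ≫ n') := by rw [hn']; exact hn
        exact mono_of_mono e n'
      have hP := hproj M hM
      have hf : x ≫ Projective.factorThru y e = f := by
        rw [← cancel_mono e, Category.assoc, Projective.factorThru_comp, hxy]
      obtain ⟨r, hr, -⟩ := hc.2 (𝟙 N)
        ⟨M, x, Projective.factorThru y e, hM, by rw [hf, Category.comp_id]⟩
      refine hFrep (Iso.mk r e ?_ hr) hH
      rw [← cancel_epi e, ← Category.assoc, hr, Category.id_comp, Category.comp_id]
  · rintro ⟨hT, hF⟩
    refine ⟨hTrep, hFrep, ?_, hseq⟩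
    intro X Y hX hY f
    obtain ⟨I, p, m, hp, hm, hpm⟩ := hfact f
    exact ⟨I, p, m, ⟨hT p hp hX, hF m hm hY⟩, hpm⟩
end
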